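/- Let r and d be integers with r < d ≤ 2r - 2, and let H = H(r,d,3r-1) be the graph with vertex set {x_1, ..., x_{2r-1}} ∪ {y_1, ..., y_r} and edge set consisting of the cycle edges x_i x_{i+1} for i = 1, ..., 2r-1 (indices modulo 2r-1, so x_{2r} = x_1), the edge x_{2r-1} y_1, the edges x_{2r-2j+2} y_j for j = 1, ..., 2r-d, the edge x_{d-r+1} y_{2r-d+1}, and the path edges y_t y_{t+1} for t = 2r-d+1, ..., r-1 (present when d ≥ r+2). Then H is radially maximal. -/

import Mathlib

open SimpleGraph

/-- The eccentricity of a vertex `v`: the maximum distance from `v` to any vertex. -/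
noncomputable def eccentricity {V : Type*} [Fintype V] (G : SimpleGraph V) (v : V) : ℕ :=
  Finset.univ.sup fun u => G.dist v u

/-- The radius of a graph: the minimum eccentricity over all vertices. -/
noncomputable def graphRadius {V : Type*} [Fintype V] (G : SimpleGraph V) : ℕ :=
  ⨅ v, eccentricity G v

/-- The diameter of a graph: the maximum eccentricity over all vertices. -/
noncomputable def graphDiam {V : Type*} [Fintype V] (G : SimpleGraph V) : ℕ :=
  Finset.univ.sup fun v => eccentricity G v

/-- A connected graph is radially maximal if it is not complete and adding
any edge of the complement strictly decreases the radius. -/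
def RadiallyMaximal {V : Type*} [Fintype V] (G : SimpleGraph V) : Prop :=
  G.Connected ∧ G ≠ ⊤ ∧ ∀ u v : V, u ≠ v → ¬ G.Adj u v →
    graphRadius (G ⊔ SimpleGraph.edge u v) < graphRadius G

/-- The graph `H(r,d,3r-1)` of the paper. Vertex `x_i` (for `i = 1, …, 2r-1`)
is `Sum.inl ⟨i-1⟩` and vertex `y_j` (for `j = 1, …, r`) is `Sum.inr ⟨j-1⟩`.
Edges: the cycle `x_i x_{i+1}` (indices mod `2r-1`, so `x_{2r} = x_1`), the
edge `x_{2r-1} y_1`, the edges `x_{2r-2j+2} y_j` for `j = 1, …, 2r-d`, the edge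
`x_{d-r+1} y_{2r-d+1}`, and the path edges `y_t y_{t+1}` for
`t = 2r-d+1, …, r-1`. -/
def paperH (r d : ℕ) : SimpleGraph (Fin (2 * r - 1) ⊕ Fin r) :=
  SimpleGraph.fromRel (fun u w => match u, w with
    | Sum.inl a, Sum.inl b => b.val = (a.val + 1) % (2 * r - 1)
    | Sum.inl a, Sum.inr b =>
        (a.val = 2 * r - 2 ∧ b.val = 0) ∨
        (b.val + 1 ≤ 2 * r - d ∧ a.val = (2 * r - 2 * (b.val + 1) + 1) % (2 * r - 1)) ∨
        (a.val = d - r ∧ b.val = 2 * r - d)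
    | Sum.inr a, Sum.inr b => 2 * r - d ≤ a.val ∧ a.val + 2 ≤ r ∧ b.val = a.val + 1
    | Sum.inr _, Sum.inl _ => False)


open SimpleGraph

def cycD (r a b : ℕ) : ℕ := min (a - b + (b - a)) (2 * r - 1 - (a - b + (b - a)))
def bas (r m j : ℕ) : ℕ := if j = 0 then 0 else if j < m then 2 * r - 2 * j - 1 else r - m
def dep (m j : ℕ) : ℕ := if j < m then 1 else j + 1 - m

structure DBd (r m : ℕ) (D : Fin (2 * r - 1) ⊕ Fin r → Fin (2 * r - 1) ⊕ Fin r → ℕ) : Prop where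
  tri : ∀ a b c, D a c ≤ D a b + D b c
  symm : ∀ a b, D a b = D b a
  xx : ∀ a b : Fin (2 * r - 1), D (Sum.inl a) (Sum.inl b) ≤ cycD r a b
  xy : ∀ (a : Fin (2 * r - 1)) (j : Fin r),
    D (Sum.inl a) (Sum.inr j) ≤ cycD r a (bas r m j) + dep m j
  y0 : ∀ (a : Fin (2 * r - 1)) (j : Fin r), j.val = 0 →
    D (Sum.inl a) (Sum.inr j) ≤ cycD r a (2 * r - 2) + 1
  yy : ∀ (j k : Fin r), m ≤ j.val → m ≤ k.val →
    D (Sum.inr j) (Sum.inr k) ≤ (j.val - k.val) + (k.val - j.val)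

section choice
variable {r m : ℕ} {D : Fin (2 * r - 1) ⊕ Fin r → Fin (2 * r - 1) ⊕ Fin r → ℕ}

/-- A pendant centre. -/
theorem centreA (H : DBd r m D) (h2 : 2 ≤ m) (hm : m + 1 ≤ r) (c : Fin (2 * r - 1)) (k : Fin r)
    (hk : 1 ≤ k.val) (hkm : k.val < m) (hc : cycD r c (2 * r - 2 * k - 1) = r - 1)
    (hD : D (Sum.inl c) (Sum.inr k) ≤ r - 1) : ∀ t, D (Sum.inl c) t ≤ r - 1 := by
  rintro (b | j)
  · have := H.xx c b
    unfold cycD at this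
    omega
  · by_cases hjk : j = k
    · subst hjk; exact hD
    have hjk' : j.val ≠ k.val := fun h => hjk (Fin.ext h)
    have h1 := H.xy c j
    have h3 := H.y0 c j
    have hcl := c.isLt
    have hjl := j.isLt
    unfold bas dep cycD at *
    by_cases hj0 : j.val = 0
    · have h3 := h3 hj0
      simp only [hj0, if_true] at h1
      rw [if_pos (by omega)] at h1
      omega
    · by_cases hjm : j.val < m
      · simp only [hj0, hjm, if_true, if_false] at h1
        omega
      · simp only [hj0, hjm, if_false] at h1
        omega

theorem centreB (H : DBd r m D) (h2 : 2 ≤ m) (hm : m + 1 ≤ r) (c : Fin (2 * r - 1)) (k : Fin r)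
    (hk : k.val = 0) (hc : c.val = r - 1)
    (hD : D (Sum.inl c) (Sum.inr k) ≤ r - 1) : ∀ t, D (Sum.inl c) t ≤ r - 1 := by
  rintro (b | j)
  · have := H.xx c b
    unfold cycD at this
    omega
  · by_cases hjk : j = k
    · subst hjk; exact hD
    have hjk' : j.val ≠ k.val := fun h => hjk (Fin.ext h)
    have h1 := H.xy c j
    have hjl := j.isLt
    unfold bas dep cycD at *
    rw [if_neg (by omega)] at h1
    by_cases hjm : j.val < m
    · simp only [hjm, if_true] at h1
      omega
    · simp only [hjm, if_false] at h1
      omega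

theorem centreC (H : DBd r m D) (h2 : 2 ≤ m) (hm : m + 1 ≤ r) (c : Fin (2 * r - 1))
    (hc : m ≤ cycD r c (r - m))
    (hD : ∀ k : Fin r, m ≤ k.val → D (Sum.inl c) (Sum.inr k) ≤ r - 1) :
    ∀ t, D (Sum.inl c) t ≤ r - 1 := by
  rintro (b | j)
  · have := H.xx c b
    unfold cycD at this
    omega
  · by_cases hjm : m ≤ j.val
    · exact hD j hjm
    have h1 := H.xy c j
    have h3 := H.y0 c j
    have hjl := j.isLt
    have hcl := c.isLt
    unfold bas dep cycD at *
    rw [if_pos (show j.val < m by omega)] at h1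
    by_cases hj0 : j.val = 0
    · have h3 := h3 hj0
      rw [if_pos hj0] at h1
      omega
    · rw [if_neg hj0, if_pos (by omega)] at h1
      omega

theorem cycD_le1 (r a b : ℕ) : cycD r a b ≤ a - b + (b - a) := by unfold cycD; omega
theorem cycD_le2 (r a b : ℕ) : cycD r a b ≤ 2 * r - 1 - (a - b + (b - a)) := by unfold cycD; omega

theorem balB (H : DBd r m D) (h2 : 2 ≤ m) (hm : m + 1 ≤ r) (a b : Fin (2 * r - 1))
    (hab : a.val + 2 ≤ b.val) 
    (he : D (Sum.inl a) (Sum.inl b) ≤ 1) (k0 : Fin r) (c : Fin (2 * r - 1)) (hk0 : k0.val = 0)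
    (hcv : c.val = r - 1) (hB : ¬ D (Sum.inl c) (Sum.inr k0) ≤ r - 1) :
    a.val < r - 1 ∧ r - 1 < b.val ∧ a.val + b.val + 1 ≤ 2 * r ∧ 2 * r ≤ a.val + b.val + 3 := by
  have hbl := b.isLt
  have he' := he
  rw [H.symm] at he'
  -- y_0 estimates
  have ya1 := H.xy a k0
  have ya2 := H.y0 a k0 hk0
  have yb1 := H.xy b k0
  have yb2 := H.y0 b k0 hk0
  have ca := H.xx c a
  have cb := H.xx c b
  have t1 := H.tri (Sum.inl c) (Sum.inl a) (Sum.inr k0)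
  have t2 := H.tri (Sum.inl c) (Sum.inl b) (Sum.inr k0)
  have t3 := H.tri (Sum.inl a) (Sum.inl b) (Sum.inr k0)
  have t4 := H.tri (Sum.inl b) (Sum.inl a) (Sum.inr k0)
  simp only [bas, dep, hk0, if_true, if_pos (show 0 < m by omega), hcv] at ya1 ya2 yb1 yb2 ca cb
  have z1 := cycD_le1 r a 0
  have z2 := cycD_le1 r a (2 * r - 2)
  have z4 := cycD_le1 r b (2 * r - 2)
  have z5 := cycD_le1 r (r - 1) a
  have z6 := cycD_le1 r (r - 1) b
  clear H
  show a.val < r - 1 ∧ r - 1 < b.val ∧ a.val + b.val + 1 ≤ 2 * r ∧ 2 * r ≤ a.val + b.val + 3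
  refine ⟨?_, ?_, ?_, ?_⟩ <;> omega

theorem balA (H : DBd r m D) (h2 : 2 ≤ m) (hm : m + 1 ≤ r) (a b : Fin (2 * r - 1))
    (he : D (Sum.inl a) (Sum.inl b) ≤ 1) (k1 : Fin r) (e1 e2 : Fin (2 * r - 1)) (hk1 : k1.val = 1)
    (he1 : e1.val = r - 3) (he2 : e2.val = r - 2)
    (hA1 : ¬ D (Sum.inl e1) (Sum.inr k1) ≤ r - 1) (hA2 : ¬ D (Sum.inl e2) (Sum.inr k1) ≤ r - 1)
    (q1 : a.val < r - 1) (q2 : r - 1 < b.val) (q3 : a.val + b.val + 1 ≤ 2 * r)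
    (q4 : 2 * r ≤ a.val + b.val + 3) (hex : ¬ (r = 3 ∧ a.val = 1 ∧ b.val = 4))
    (hw : ¬ (a.val = 0 ∧ b.val = 2 * r - 2)) : False := by
  have hbl := b.isLt
  have yb := H.xy b k1
  have c1a := H.xx e1 a
  have c2a := H.xx e2 a
  have t1 := H.tri (Sum.inl e1) (Sum.inl a) (Sum.inr k1)
  have t3 := H.tri (Sum.inl e2) (Sum.inl a) (Sum.inr k1)
  have t5 := H.tri (Sum.inl a) (Sum.inl b) (Sum.inr k1)
  simp only [bas, dep, hk1, if_pos (show 1 < m by omega), he1, he2, one_ne_zero, if_false] at yb c1a c2a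
  have z3 := cycD_le1 r b (2 * r - 3)
  have z5 := cycD_le1 r (r - 3) a
  have z8 := cycD_le1 r (r - 2) a
  rw [show 2 * r - 2 * 1 - 1 = 2 * r - 3 by omega] at yb
  clear H
  by_cases h : a.val = r - 2
  · omega
  · omega

theorem caseXX (H : DBd r m D) (h2 : 2 ≤ m) (hm : m + 1 ≤ r) (a b : Fin (2 * r - 1))
    (hab : a.val + 2 ≤ b.val) (hw : ¬ (a.val = 0 ∧ b.val = 2 * r - 2))
    (he : D (Sum.inl a) (Sum.inl b) ≤ 1) : ∃ w, ∀ t, D w t ≤ r - 1 := by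
  have hbl := b.isLt
  have he' := he
  rw [H.symm] at he'
  let k0 : Fin r := ⟨0, by omega⟩
  let k1 : Fin r := ⟨1, by omega⟩
  let c : Fin (2 * r - 1) := ⟨r - 1, by omega⟩
  by_cases hB : D (Sum.inl c) (Sum.inr k0) ≤ r - 1
  · exact ⟨_, centreB H h2 hm c k0 rfl rfl hB⟩
  obtain ⟨q1, q2, q3, q4⟩ := balB H h2 hm a b hab he k0 c rfl rfl hB
  by_cases hex : r = 3 ∧ a.val = 1 ∧ b.val = 4
  · obtain ⟨rfl, ha, hb⟩ := hex
    have hm2 : m = 2 := by omega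
    subst hm2
    refine ⟨_, centreC H h2 hm b (by rw [hb]; decide) ?_⟩
    intro k hk
    have hkl := k.isLt
    have hk2 : k.val = 2 := by omega
    have := H.xy a k
    have := H.tri (Sum.inl b) (Sum.inl a) (Sum.inr k)
    simp only [hk2, ha] at *
    simp [bas, dep, cycD] at *
    omega
  let e1 : Fin (2 * r - 1) := ⟨r - 3, by omega⟩
  let e2 : Fin (2 * r - 1) := ⟨r - 2, by omega⟩
  have hk1 : k1.val = 1 := rfl
  have he1 : e1.val = r - 3 := rfl
  have he2 : e2.val = r - 2 := rfl
  by_cases hA1 : D (Sum.inl e1) (Sum.inr k1) ≤ r - 1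
  · exact ⟨_, centreA H h2 hm e1 k1 (by omega) (by omega) (by unfold cycD; omega) hA1⟩
  by_cases hA2 : D (Sum.inl e2) (Sum.inr k1) ≤ r - 1
  · exact ⟨_, centreA H h2 hm e2 k1 (by omega) (by omega) (by unfold cycD; omega) hA2⟩
  exact (balA H h2 hm a b he k1 e1 e2 rfl rfl rfl hA1 hA2 q1 q2 q3 q4 hex hw).elim

/-- edge between a pendant `y_k` and anything close to one of the two antipodes -/
theorem casePX (H : DBd r m D) (h2 : 2 ≤ m) (hm : m + 1 ≤ r) (k : Fin r) (a : Fin (2 * r - 1))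
    (hk : 1 ≤ k.val) (hkm : k.val < m) (ha : a.val ≠ 2 * r - 2 * k - 1)
    (he : D (Sum.inl a) (Sum.inr k) ≤ 1) : ∃ w, ∀ t, D w t ≤ r - 1 := by
  have hal := a.isLt
  have hkl := k.isLt
  have main : ∃ c : Fin (2 * r - 1), cycD r c (2 * r - 2 * k - 1) = r - 1 ∧ cycD r c a ≤ r - 2 := by
    unfold cycD
    by_cases h0 : 2 * r - 2 * k - 1 = r - 1
    · by_cases h3 : a.val < r - 1
      · exact ⟨⟨0, by omega⟩, by dsimp only; omega, by dsimp only; omega⟩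
      · exact ⟨⟨2 * r - 2, by omega⟩, by dsimp only; omega, by dsimp only; omega⟩
    by_cases h1 : 2 * r - 2 * k - 1 ≤ r - 1
    · by_cases h3 : a.val < 2 * r - 2 * k - 1 ∨ 2 * r - 2 * k - 1 + r ≤ a.val
      · exact ⟨⟨2 * r - 2 * k - 1 + r, by omega⟩, by dsimp only; omega, by dsimp only; omega⟩
      · exact ⟨⟨2 * r - 2 * k - 1 + r - 1, by omega⟩, by dsimp only; omega, by dsimp only; omega⟩
    · by_cases h3 : 2 * r - 2 * k - 1 < a.val ∨ a.val ≤ 2 * r - 2 * k - 1 - r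
      · exact ⟨⟨2 * r - 2 * k - 1 - r, by omega⟩, by dsimp only; omega, by dsimp only; omega⟩
      · exact ⟨⟨2 * r - 2 * k - 1 - (r - 1), by omega⟩, by dsimp only; omega, by dsimp only; omega⟩
  obtain ⟨c, h1, h3⟩ := main
  refine ⟨_, centreA H h2 hm c k hk hkm h1 ?_⟩
  have := H.xx c a
  have := H.tri (Sum.inl c) (Sum.inl a) (Sum.inr k)
  omega

theorem casePY (H : DBd r m D) (h2 : 2 ≤ m) (hm : m + 1 ≤ r) (k j : Fin r)
    (hk : 1 ≤ k.val) (hkm : k.val < m) (hj : j ≠ k)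
    (he : D (Sum.inr j) (Sum.inr k) ≤ 1) : ∃ w, ∀ t, D w t ≤ r - 1 := by
  have hj' : j.val ≠ k.val := fun h => hj (Fin.ext h)
  have hjl := j.isLt
  have hkl := k.isLt
  have main : ∃ c : Fin (2 * r - 1), cycD r c (2 * r - 2 * k - 1) = r - 1 ∧
      cycD r c (bas r m j) + dep m j ≤ r - 2 := by
    have hb : bas r m j < 2 * r - 1 := by unfold bas; split_ifs <;> omega
    have hd : (j.val < m ∧ dep m j = 1 ∧ ((j.val = 0 ∧ bas r m j = 0) ∨
      (1 ≤ j.val ∧ bas r m j = 2 * r - 2 * j - 1))) ∨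
      (m ≤ j.val ∧ dep m j = j + 1 - m ∧ bas r m j = r - m) := by
      unfold bas dep; split_ifs <;> omega
    generalize bas r m j = B at *
    generalize dep m j = E at *
    unfold cycD
    by_cases h0 : 2 * r - 2 * k - 1 = r - 1
    · by_cases h3 : B < r - 1
      · exact ⟨⟨0, by omega⟩, by dsimp only; omega, by dsimp only; omega⟩
      · exact ⟨⟨2 * r - 2, by omega⟩, by dsimp only; omega, by dsimp only; omega⟩
    by_cases h1 : 2 * r - 2 * k - 1 ≤ r - 1
    · by_cases h3 : B < 2 * r - 2 * k - 1 ∨ 2 * r - 2 * k - 1 + r ≤ B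
      · exact ⟨⟨2 * r - 2 * k - 1 + r, by omega⟩, by dsimp only; omega, by dsimp only; omega⟩
      · exact ⟨⟨2 * r - 2 * k - 1 + r - 1, by omega⟩, by dsimp only; omega, by dsimp only; omega⟩
    · by_cases h3 : 2 * r - 2 * k - 1 < B ∨ B ≤ 2 * r - 2 * k - 1 - r
      · exact ⟨⟨2 * r - 2 * k - 1 - r, by omega⟩, by dsimp only; omega, by dsimp only; omega⟩
      · exact ⟨⟨2 * r - 2 * k - 1 - (r - 1), by omega⟩, by dsimp only; omega, by dsimp only; omega⟩
  obtain ⟨c, h1, h3⟩ := main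
  refine ⟨_, centreA H h2 hm c k hk hkm h1 ?_⟩
  have := H.xy c j
  have := H.tri (Sum.inl c) (Sum.inr j) (Sum.inr k)
  omega

theorem caseY0X (H : DBd r m D) (h2 : 2 ≤ m) (hm : m + 1 ≤ r) (k : Fin r) (a : Fin (2 * r - 1))
    (hk : k.val = 0) (ha : a.val ≠ 0) (ha' : a.val ≠ 2 * r - 2)
    (he : D (Sum.inl a) (Sum.inr k) ≤ 1) : ∃ w, ∀ t, D w t ≤ r - 1 := by
  have hal := a.isLt
  let c : Fin (2 * r - 1) := ⟨r - 1, by omega⟩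
  have hcv : c.val = r - 1 := rfl
  refine ⟨_, centreB H h2 hm c k hk rfl ?_⟩
  have h1 := H.xx c a
  have := H.tri (Sum.inl c) (Sum.inl a) (Sum.inr k)
  unfold cycD at h1
  omega

/-- bounds from the "left" tail centre -/
theorem caseTT (H : DBd r m D) (h2 : 2 ≤ m) (hm : m + 1 ≤ r) (k j : Fin r)
    (hk : m ≤ k.val) (hj : k.val + 2 ≤ j.val)
    (he : D (Sum.inr k) (Sum.inr j) ≤ 1) : ∃ w, ∀ t, D w t ≤ r - 1 := by
  have hjl := j.isLt
  let c : Fin (2 * r - 1) := ⟨r, by omega⟩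
  have hcv : c.val = r := rfl
  refine ⟨_, centreC H h2 hm c (by unfold cycD; omega) ?_⟩
  intro l hl
  have hll := l.isLt
  have h1 := H.xy c l
  have h3 := H.xy c k
  have h4 := H.yy j l (by omega) hl
  have := H.tri (Sum.inl c) (Sum.inr k) (Sum.inr j)
  have := H.tri (Sum.inl c) (Sum.inr j) (Sum.inr l)
  unfold bas dep cycD at h1 h3
  rw [if_neg (by omega), if_neg (by omega), if_neg (by omega)] at h1 h3
  omega

theorem caseTX (H : DBd r m D) (h2 : 2 ≤ m) (hm : m + 1 ≤ r) (k : Fin r) (a : Fin (2 * r - 1))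
    (hk : m ≤ k.val) (ha : ¬ (a.val = r - m ∧ k.val = m))
    (he : D (Sum.inl a) (Sum.inr k) ≤ 1) : ∃ w, ∀ t, D w t ≤ r - 1 := by
  have hkl := k.isLt
  have hal := a.isLt
  by_cases hfar : m ≤ cycD r a (r - m)
  · refine ⟨_, centreC H h2 hm a hfar ?_⟩
    intro l hl
    have := H.yy k l hk hl
    have := H.tri (Sum.inl a) (Sum.inr k) (Sum.inr l)
    omega
  have main : ∃ c : Fin (2 * r - 1), cycD r c (r - m) = m ∧
      cycD r c a + cycD r a (r - m) = m := by
    unfold cycD at *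
    by_cases h1 : r - m ≤ a.val ∧ a.val ≤ r
    · exact ⟨⟨r, by omega⟩, by dsimp only; omega, by dsimp only; omega⟩
    · by_cases h3 : m ≤ r - m
      · exact ⟨⟨r - m - m, by omega⟩, by dsimp only; omega, by dsimp only; omega⟩
      · exact ⟨⟨r - m + (2 * r - 1) - m, by omega⟩, by dsimp only; omega, by dsimp only; omega⟩
  obtain ⟨c, h1, h3⟩ := main
  refine ⟨_, centreC H h2 hm c (by omega) ?_⟩
  intro l hl
  have hll := l.isLt
  have h5 := H.xy c l
  have h6 := H.xx c a
  have := H.yy k l hk hl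
  have := H.tri (Sum.inl c) (Sum.inl a) (Sum.inr k)
  have := H.tri (Sum.inl c) (Sum.inr k) (Sum.inr l)
  have h7 : cycD r a (r - m) = 0 → a.val = r - m := by unfold cycD; omega
  unfold bas dep at h5
  rw [if_neg (by omega), if_neg (by omega), if_neg (by omega)] at h5
  omega

theorem caseTY0 (H : DBd r m D) (h2 : 2 ≤ m) (hm : m + 1 ≤ r) (k j : Fin r)
    (hk : m ≤ k.val) (hj : j.val = 0)
    (he : D (Sum.inr k) (Sum.inr j) ≤ 1) : ∃ w, ∀ t, D w t ≤ r - 1 := by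
  have hkl := k.isLt
  by_cases hlast : k.val + 1 < r
  · let c : Fin (2 * r - 1) := ⟨r - 1, by omega⟩
    have hcv : c.val = r - 1 := rfl
    refine ⟨_, centreB H h2 hm c j hj rfl ?_⟩
    have h1 := H.xy c k
    have := H.tri (Sum.inl c) (Sum.inr k) (Sum.inr j)
    unfold bas dep cycD at h1
    rw [if_neg (by omega), if_neg (by omega), if_neg (by omega)] at h1
    omega
  have main : ∃ c : Fin (2 * r - 1), cycD r c (r - m) = m ∧
      (cycD r c 0 ≤ r - 3 ∨ cycD r c (2 * r - 2) ≤ r - 3) := by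
    unfold cycD at *
    by_cases h3 : m ≤ r - m
    · exact ⟨⟨r - m - m, by omega⟩, by dsimp only; omega, by dsimp only; omega⟩
    · exact ⟨⟨r - m + (2 * r - 1) - m, by omega⟩, by dsimp only; omega, by dsimp only; omega⟩
  obtain ⟨c, h1, h3⟩ := main
  refine ⟨_, centreC H h2 hm c (by omega) ?_⟩
  intro l hl
  have hll := l.isLt
  have h5 := H.xy c l
  have h6 := H.xy c j
  have h8 := H.y0 c j hj
  have := H.yy k l hk hl
  have := H.tri (Sum.inl c) (Sum.inr j) (Sum.inr k)
  have := H.symm (Sum.inr k) (Sum.inr j)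
  have := H.tri (Sum.inl c) (Sum.inr k) (Sum.inr l)
  unfold bas dep at h5 h6
  rw [if_neg (by omega), if_neg (by omega), if_neg (by omega)] at h5
  rw [if_pos (by omega), if_pos (by omega)] at h6
  omega

end choice
def Wk {V : Type*} (G : SimpleGraph V) (k : ℕ) (u v : V) : Prop := ∃ p : G.Walk u v, p.length ≤ k

theorem Wk.trans' {V : Type*} {G : SimpleGraph V} {k l : ℕ} {u v w : V} (h : Wk G k u v)
    (h' : Wk G l v w) : Wk G (k + l) u w := by
  obtain ⟨p, hp⟩ := h
  obtain ⟨q, hq⟩ := h'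
  exact ⟨p.append q, by rw [Walk.length_append]; omega⟩

theorem Wk.symm' {V : Type*} {G : SimpleGraph V} {k : ℕ} {u v : V} (h : Wk G k u v) :
    Wk G k v u := by
  obtain ⟨p, hp⟩ := h
  exact ⟨p.reverse, by rw [Walk.length_reverse]; omega⟩

theorem Wk.mono' {V : Type*} {G : SimpleGraph V} {k l : ℕ} {u v : V} (h : Wk G k u v)
    (hl : k ≤ l) : Wk G l u v := by
  obtain ⟨p, hp⟩ := h
  exact ⟨p, by omega⟩

theorem Wk.adj' {V : Type*} {G : SimpleGraph V} {u v : V} (h : G.Adj u v) : Wk G 1 u v :=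
  ⟨h.toWalk, by simp⟩

theorem Wk.refl' {V : Type*} {G : SimpleGraph V} (u : V) : Wk G 0 u u :=
  ⟨Walk.nil, by simp⟩

theorem Wk.dist' {V : Type*} {G : SimpleGraph V} {k : ℕ} {u v : V} (h : Wk G k u v) :
    G.dist u v ≤ k := by
  obtain ⟨p, hp⟩ := h
  exact (dist_le p).trans hp

section graph
variable {r d m : ℕ}

theorem adj_succ (hr : 3 ≤ r) (a b : Fin (2 * r - 1)) (h : b.val = a.val + 1) :
    (paperH r d).Adj (Sum.inl a) (Sum.inl b) := by
  refine (SimpleGraph.fromRel_adj _ _ _).2 ⟨?_, Or.inl ?_⟩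
  · intro h'
    have := congrArg Fin.val (Sum.inl.inj h')
    omega
  · show b.val = (a.val + 1) % (2 * r - 1)
    rw [Nat.mod_eq_of_lt (by omega), h]

theorem adj_wrap (hr : 3 ≤ r) (a b : Fin (2 * r - 1)) (h : a.val = 0) (hb : b.val = 2 * r - 2) :
    (paperH r d).Adj (Sum.inl a) (Sum.inl b) := by
  refine (SimpleGraph.fromRel_adj _ _ _).2 ⟨?_, Or.inr ?_⟩
  · intro h'
    have := congrArg Fin.val (Sum.inl.inj h')
    omega
  · show a.val = (b.val + 1) % (2 * r - 1)
    rw [h, hb, show 2 * r - 2 + 1 = 2 * r - 1 by omega, Nat.mod_self]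

theorem adj_base (h2 : 2 ≤ m) (hm : m + 1 ≤ r) (hd : d = 2 * r - m)
    (a : Fin (2 * r - 1)) (j : Fin r) (hj : j.val ≤ m)
    (h : a.val = bas r m j) : (paperH r d).Adj (Sum.inl a) (Sum.inr j) := by
  refine (SimpleGraph.fromRel_adj _ _ _).2 ⟨by simp, Or.inl ?_⟩
  show (a.val = 2 * r - 2 ∧ j.val = 0) ∨
        (j.val + 1 ≤ 2 * r - d ∧ a.val = (2 * r - 2 * (j.val + 1) + 1) % (2 * r - 1)) ∨
        (a.val = d - r ∧ j.val = 2 * r - d)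
  unfold bas at h
  split_ifs at h with h0 h1
  · right; left
    refine ⟨by omega, ?_⟩
    rw [h, h0, show 2 * r - 2 * (0 + 1) + 1 = 2 * r - 1 by omega, Nat.mod_self]
  · right; left
    refine ⟨by omega, ?_⟩
    rw [h, Nat.mod_eq_of_lt (by omega)]
    omega
  · right; right
    omega

theorem adj_y0 (a : Fin (2 * r - 1)) (j : Fin r) (hj : j.val = 0)
    (h : a.val = 2 * r - 2) : (paperH r d).Adj (Sum.inl a) (Sum.inr j) :=
  (SimpleGraph.fromRel_adj _ _ _).2 ⟨by simp, Or.inl (Or.inl ⟨h, hj⟩)⟩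

theorem adj_yy (hm : m + 1 ≤ r) (hd : d = 2 * r - m) (j k : Fin r) (hj : m ≤ j.val)
    (h : k.val = j.val + 1) : (paperH r d).Adj (Sum.inr j) (Sum.inr k) := by
  have := k.isLt
  refine (SimpleGraph.fromRel_adj _ _ _).2 ⟨?_, Or.inl ?_⟩
  · intro h'
    have := congrArg Fin.val (Sum.inr.inj h')
    omega
  · show 2 * r - d ≤ j.val ∧ j.val + 2 ≤ r ∧ k.val = j.val + 1
    omega

theorem wk_x_le (hr : 3 ≤ r) : ∀ (k : ℕ) (a b : Fin (2 * r - 1)), b.val = a.val + k →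
    Wk (paperH r d) k (Sum.inl a) (Sum.inl b) := by
  intro k
  induction k with
  | zero =>
    intro a b h
    have : a = b := Fin.ext (by omega)
    subst this
    exact Wk.refl' _
  | succ k ih =>
    intro a b h
    have hb := b.isLt
    exact (ih a ⟨a.val + k, by omega⟩ rfl).trans' (Wk.adj' (adj_succ hr _ _ (by dsimp only; omega)))

theorem wk_xx (hr : 3 ≤ r) (a b : Fin (2 * r - 1)) :
    Wk (paperH r d) (cycD r a b) (Sum.inl a) (Sum.inl b) := by
  wlog hab : a.val ≤ b.val with H
  · have := (H (d := d) hr b a (by omega)).symm'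
    exact this.mono' (by unfold cycD; omega)
  have hb := b.isLt
  have h1 := wk_x_le (d := d) hr (b.val - a.val) a b (by omega)
  let o : Fin (2 * r - 1) := ⟨0, by omega⟩
  let e : Fin (2 * r - 1) := ⟨2 * r - 2, by omega⟩
  have h2 := (wk_x_le (d := d) hr a.val o a (by simp [o])).symm'
  have h3 := Wk.adj' (adj_wrap (d := d) hr o e rfl rfl)
  have h4 := (wk_x_le (d := d) hr (2 * r - 2 - b.val) b e (by simp only [e]; omega)).symm'
  have h5 := (h2.trans' h3).trans' h4
  unfold cycD
  rcases le_total (a.val - b.val + (b.val - a.val)) (2 * r - 1 - (a.val - b.val + (b.val - a.val)))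
    with h | h
  · rw [min_eq_left h]; exact h1.mono' (by omega)
  · rw [min_eq_right h]; exact h5.mono' (by omega)

theorem wk_y_le (hm : m + 1 ≤ r) (hd : d = 2 * r - m) : ∀ (k : ℕ) (a b : Fin r), m ≤ a.val →
    b.val = a.val + k → Wk (paperH r d) k (Sum.inr a) (Sum.inr b) := by
  intro k
  induction k with
  | zero =>
    intro a b _ h
    have : a = b := Fin.ext (by omega)
    subst this
    exact Wk.refl' _
  | succ k ih =>
    intro a b ha h
    have hb := b.isLt
    exact (ih a ⟨a.val + k, by omega⟩ ha rfl).trans'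
      (Wk.adj' (adj_yy hm hd _ _ (by dsimp only; omega) (by dsimp only; omega)))

theorem bas_lt (h2 : 2 ≤ m) (hm : m + 1 ≤ r) (j : ℕ) : bas r m j < 2 * r - 1 := by
  unfold bas; split_ifs <;> omega

theorem wk_xy (h2 : 2 ≤ m) (hm : m + 1 ≤ r) (hd : d = 2 * r - m)
    (a : Fin (2 * r - 1)) (j : Fin r) :
    Wk (paperH r d) (cycD r a (bas r m j) + dep m j) (Sum.inl a) (Sum.inr j) := by
  let B : Fin (2 * r - 1) := ⟨bas r m j, bas_lt h2 hm j⟩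
  have h1 := wk_xx (d := d) (by omega) a B
  refine h1.trans' ?_
  by_cases hj : j.val < m
  · exact (Wk.adj' (adj_base h2 hm hd B j (by omega) rfl)).mono' (by unfold dep; split_ifs; omega)
  · let k : Fin r := ⟨m, by omega⟩
    have hk : bas r m j = bas r m k := by
      simp only [bas, k]
      rw [if_neg (by omega), if_neg (by omega), if_neg (by omega), if_neg (by omega)]
    have h3 := Wk.adj' (adj_base h2 hm hd B k (by simp [k]) hk)
    have h4 := wk_y_le hm hd (j.val - m) k j (by simp [k]) (by simp only [k]; omega)
    exact (h3.trans' h4).mono' (by unfold dep; split_ifs; omega)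

theorem wk_y0 (hr : 3 ≤ r) (a : Fin (2 * r - 1)) (j : Fin r) (hj : j.val = 0) :
    Wk (paperH r d) (cycD r a (2 * r - 2) + 1) (Sum.inl a) (Sum.inr j) := by
  let B : Fin (2 * r - 1) := ⟨2 * r - 2, by omega⟩
  exact (wk_xx (d := d) hr a B).trans' (Wk.adj' (adj_y0 B j hj rfl))

theorem wk_yy (hm : m + 1 ≤ r) (hd : d = 2 * r - m) (j k : Fin r) (hj : m ≤ j.val)
    (hk : m ≤ k.val) :
    Wk (paperH r d) ((j.val - k.val) + (k.val - j.val)) (Sum.inr j) (Sum.inr k) := by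
  rcases le_total j.val k.val with h | h
  · exact (wk_y_le hm hd (k.val - j.val) j k hj (by omega)).mono' (by omega)
  · exact (wk_y_le hm hd (j.val - k.val) k j hk (by omega)).symm'.mono' (by omega)

theorem conn (h2 : 2 ≤ m) (hm : m + 1 ≤ r) (hd : d = 2 * r - m) : (paperH r d).Connected := by
  let o : Fin (2 * r - 1) := ⟨0, by omega⟩
  haveI : Nonempty (Fin (2 * r - 1) ⊕ Fin r) := ⟨Sum.inl o⟩
  have key : ∀ t, (paperH r d).Reachable (Sum.inl o) t := by
    rintro (b | j)
    · obtain ⟨p, -⟩ := wk_xx (d := d) (by omega) o b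
      exact ⟨p⟩
    · obtain ⟨p, -⟩ := wk_xy h2 hm hd o j
      exact ⟨p⟩
  exact ⟨fun u v => (key u).symm.trans (key v)⟩

theorem dbd (h2 : 2 ≤ m) (hm : m + 1 ≤ r) (hd : d = 2 * r - m)
    (G : SimpleGraph (Fin (2 * r - 1) ⊕ Fin r)) (hG : paperH r d ≤ G) :
    DBd r m G.dist where
  tri a b c := ((conn h2 hm hd).mono hG).dist_triangle
  symm a b := dist_comm
  xx a b := (Reachable.dist_anti hG ((conn h2 hm hd) _ _)).trans (wk_xx (by omega) a b).dist'
  xy a b := (Reachable.dist_anti hG ((conn h2 hm hd) _ _)).trans (wk_xy h2 hm hd a b).dist'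
  y0 a b h := (Reachable.dist_anti hG ((conn h2 hm hd) _ _)).trans (wk_y0 (by omega) a b h).dist'
  yy a b h h' := (Reachable.dist_anti hG ((conn h2 hm hd) _ _)).trans (wk_yy hm hd a b h h').dist'

/-- the explicit distance from `x_c` -/
def fc (r m c : ℕ) : Fin (2 * r - 1) ⊕ Fin r → ℕ
  | Sum.inl b => cycD r c b
  | Sum.inr j => if j.val = 0 then min (cycD r c 0) (cycD r c (2 * r - 2)) + 1
      else cycD r c (bas r m j) + dep m j

theorem cycD_lip (r c a b : ℕ) (hc : c < 2 * r - 1) (ha : a < 2 * r - 1) (hb : b < 2 * r - 1)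
    (h : b = (a + 1) % (2 * r - 1)) :
    cycD r c a ≤ cycD r c b + 1 ∧ cycD r c b ≤ cycD r c a + 1 := by
  unfold cycD
  by_cases h1 : a + 1 < 2 * r - 1
  · rw [Nat.mod_eq_of_lt h1] at h
    omega
  · rw [show a + 1 = 2 * r - 1 by omega, Nat.mod_self] at h
    omega

theorem fc_lip (h2 : 2 ≤ m) (hm : m + 1 ≤ r) (hd : d = 2 * r - m) (c : ℕ) (hc : c < 2 * r - 1)
    (u v) (h : (paperH r d).Adj u v) : fc r m c u ≤ fc r m c v + 1 := by
  have hxy : ∀ (a : Fin (2 * r - 1)) (j : Fin r), ((a.val = 2 * r - 2 ∧ j.val = 0) ∨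
        (j.val + 1 ≤ 2 * r - d ∧ a.val = (2 * r - 2 * (j.val + 1) + 1) % (2 * r - 1)) ∨
        (a.val = d - r ∧ j.val = 2 * r - d)) →
      fc r m c (Sum.inl a) ≤ fc r m c (Sum.inr j) + 1 ∧
      fc r m c (Sum.inr j) ≤ fc r m c (Sum.inl a) + 1 := by
    intro a j h
    simp only [fc]
    by_cases hj : j.val = 0
    · rw [if_pos hj]
      have hl : cycD r c 0 ≤ cycD r c (2 * r - 2) + 1 ∧ cycD r c (2 * r - 2) ≤ cycD r c 0 + 1 := by
        unfold cycD; omega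
      have : a.val = 2 * r - 2 ∨ a.val = 0 := by
        rcases h with h | h | h
        · exact Or.inl h.1
        · rw [hj, show 2 * r - 2 * (0 + 1) + 1 = 2 * r - 1 by omega, Nat.mod_self] at h
          exact Or.inr h.2
        · omega
      rcases this with h | h <;> rw [h] <;> omega
    · rw [if_neg hj]
      have : a.val = bas r m j ∧ dep m j = 1 := by
        unfold bas dep
        rcases h with h | h | h
        · omega
        · rw [if_neg hj, if_pos (by omega), if_pos (by omega)]
          rw [Nat.mod_eq_of_lt (by omega)] at h
          omega
        · rw [if_neg hj, if_neg (by omega), if_neg (by omega)]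
          omega
      rw [this.1, this.2]
      omega
  have hyy : ∀ (j k : Fin r), (2 * r - d ≤ j.val ∧ j.val + 2 ≤ r ∧ k.val = j.val + 1) →
      fc r m c (Sum.inr j) ≤ fc r m c (Sum.inr k) + 1 ∧
      fc r m c (Sum.inr k) ≤ fc r m c (Sum.inr j) + 1 := by
    intro j k h
    simp only [fc, bas, dep]
    rw [if_neg (by omega), if_neg (by omega), if_neg (by omega), if_neg (by omega),
      if_neg (by omega), if_neg (by omega), if_neg (by omega), if_neg (by omega)]
    omega
  obtain ⟨-, h⟩ := (SimpleGraph.fromRel_adj _ _ _).1 h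
  rcases u with a | j <;> rcases v with b | k
  · rcases h with h | h
    · exact (cycD_lip r c a b hc a.isLt b.isLt h).1
    · exact (cycD_lip r c b a hc b.isLt a.isLt h).2
  · rcases h with h | h
    · exact (hxy a k h).1
    · exact h.elim
  · rcases h with h | h
    · exact h.elim
    · exact (hxy b j h).2
  · rcases h with h | h
    · exact (hyy j k h).1
    · exact (hyy k j h).2

theorem fc_le_dist (h2 : 2 ≤ m) (hm : m + 1 ≤ r) (hd : d = 2 * r - m) (c : Fin (2 * r - 1))
    (u) : fc r m c u ≤ (paperH r d).dist (Sum.inl c) u := by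
  obtain ⟨p, hp⟩ := (conn h2 hm hd).exists_walk_length_eq_dist u (Sum.inl c)
  rw [dist_comm, ← hp]
  have key : ∀ (s t) (q : (paperH r d).Walk s t), fc r m c s ≤ fc r m c t + q.length := by
    intro s t q
    induction q with
    | nil => simp
    | cons h q ih =>
      have := fc_lip h2 hm hd c c.isLt _ _ h
      rw [Walk.length_cons]
      omega
  have := key _ _ p
  have h0 : fc r m c (Sum.inl c) = 0 := by simp [fc, cycD]
  omega

theorem ecc_ge (h2 : 2 ≤ m) (hm : m + 1 ≤ r) (hd : d = 2 * r - m) (u) :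
    r ≤ eccentricity (paperH r d) u := by
  suffices ∃ t, r ≤ (paperH r d).dist u t by
    obtain ⟨t, ht⟩ := this
    exact ht.trans (Finset.le_sup (f := fun t => (paperH r d).dist u t) (Finset.mem_univ t))
  rcases u with c | j
  · suffices ∃ t, r ≤ fc r m c t by
      obtain ⟨t, ht⟩ := this
      exact ⟨t, ht.trans (fc_le_dist h2 hm hd c t)⟩
    have hc := c.isLt
    by_cases hfar : m ≤ cycD r c (r - m)
    · refine ⟨Sum.inr ⟨r - 1, by omega⟩, ?_⟩
      simp only [fc, bas, dep]
      rw [if_neg (by omega), if_neg (by omega), if_neg (by omega), if_neg (by omega)]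
      omega
    by_cases hc' : c.val = r - 1
    · refine ⟨Sum.inr ⟨0, by omega⟩, ?_⟩
      simp only [fc, if_true, cycD, hc']
      omega
    have : ∃ k, 1 ≤ k ∧ k < m ∧ cycD r c (2 * r - 2 * k - 1) = r - 1 := by
      unfold cycD at *
      by_cases h1 : c.val < r - 1
      · exact ⟨(r - c.val) / 2, by omega, by omega, by omega⟩
      · exact ⟨(3 * r - 1 - c.val) / 2, by omega, by omega, by omega⟩
    obtain ⟨k, hk1, hk2, hk3⟩ := this
    refine ⟨Sum.inr ⟨k, by omega⟩, ?_⟩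
    simp only [fc, bas, dep]
    rw [if_neg (by omega), if_neg (by omega), if_pos hk2, if_pos hk2, hk3]
    omega
  · suffices ∃ c : Fin (2 * r - 1), r ≤ fc r m c (Sum.inr j) by
      obtain ⟨t, ht⟩ := this
      exact ⟨Sum.inl t, by rw [SimpleGraph.dist_comm]; exact ht.trans (fc_le_dist h2 hm hd t _)⟩
    by_cases hj : j.val = 0
    · refine ⟨⟨r - 1, by omega⟩, ?_⟩
      simp only [fc, cycD, if_pos hj]
      omega
    · have hb := bas_lt h2 hm j
      have hdp : 1 ≤ dep m j := by unfold dep; split_ifs <;> omega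
      simp only [fc, if_neg hj]
      generalize bas r m j = B at *
      unfold cycD
      by_cases h1 : B ≤ r - 1
      · exact ⟨⟨B + (r - 1), by omega⟩, by dsimp only; omega⟩
      · exact ⟨⟨B - (r - 1), by omega⟩, by dsimp only; omega⟩

theorem rad_ge (h2 : 2 ≤ m) (hm : m + 1 ≤ r) (hd : d = 2 * r - m) :
    r ≤ graphRadius (paperH r d) := by
  haveI : Nonempty (Fin (2 * r - 1) ⊕ Fin r) := (conn h2 hm hd).nonempty
  exact le_ciInf (ecc_ge h2 hm hd)

theorem centre_exists (h2 : 2 ≤ m) (hm : m + 1 ≤ r) (hd : d = 2 * r - m)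
    (D : Fin (2 * r - 1) ⊕ Fin r → Fin (2 * r - 1) ⊕ Fin r → ℕ) (H : DBd r m D)
    (u v) (huv : u ≠ v) (hna : ¬ (paperH r d).Adj u v) (he : D u v ≤ 1) :
    ∃ w, ∀ t, D w t ≤ r - 1 := by
  have hr : 3 ≤ r := by omega
  have XX : ∀ a b : Fin (2 * r - 1), a.val < b.val → ¬ (paperH r d).Adj (Sum.inl a) (Sum.inl b) →
      D (Sum.inl a) (Sum.inl b) ≤ 1 → ∃ w, ∀ t, D w t ≤ r - 1 := by
    intro a b hab hn he
    refine caseXX H h2 hm a b ?_ (fun h => hn (adj_wrap hr a b h.1 h.2)) he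
    by_contra h
    exact hn (adj_succ hr a b (by omega))
  have XY : ∀ (a : Fin (2 * r - 1)) (j : Fin r), ¬ (paperH r d).Adj (Sum.inl a) (Sum.inr j) →
      D (Sum.inl a) (Sum.inr j) ≤ 1 → ∃ w, ∀ t, D w t ≤ r - 1 := by
    intro a j hn he
    by_cases hj0 : j.val = 0
    · exact caseY0X H h2 hm j a hj0
        (fun h => hn (adj_base h2 hm hd a j (by omega) (by rw [h, bas, if_pos hj0])))
        (fun h => hn (adj_y0 a j hj0 h)) he
    by_cases hjm : j.val < m
    · exact casePX H h2 hm j a (by omega) hjm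
        (fun h => hn (adj_base h2 hm hd a j (by omega)
          (by rw [h, bas, if_neg hj0, if_pos hjm]))) he
    · exact caseTX H h2 hm j a (by omega)
        (fun h => hn (adj_base h2 hm hd a j (by omega)
          (by rw [h.1, bas, if_neg hj0, if_neg hjm]))) he
  have YY : ∀ (j k : Fin r), j.val < k.val → ¬ (paperH r d).Adj (Sum.inr j) (Sum.inr k) →
      D (Sum.inr j) (Sum.inr k) ≤ 1 → ∃ w, ∀ t, D w t ≤ r - 1 := by
    intro j k hjk hn he
    have he' := he
    rw [H.symm] at he'
    by_cases hkm : k.val < m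
    · exact casePY H h2 hm k j (by omega) hkm (fun h => by rw [h] at hjk; omega) he
    by_cases hj0 : j.val = 0
    · exact caseTY0 H h2 hm k j (by omega) hj0 he'
    by_cases hjm : j.val < m
    · exact casePY H h2 hm j k (by omega) hjm (fun h => by rw [h] at hjk; omega) he'
    refine caseTT H h2 hm j k (by omega) ?_ he
    by_contra h
    exact hn (adj_yy hm hd j k (by omega) (by omega))
  have he' := he
  rw [H.symm] at he'
  have hna' : ¬ (paperH r d).Adj v u := fun h => hna h.symm
  rcases u with a | j <;> rcases v with b | k
  · rcases lt_trichotomy a.val b.val with h | h | h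
    · exact XX a b h hna he
    · exact (huv (congrArg Sum.inl (Fin.ext h))).elim
    · exact XX b a h hna' he'
  · exact XY a k hna he
  · exact XY b j hna' he'
  · rcases lt_trichotomy j.val k.val with h | h | h
    · exact YY j k h hna he
    · exact (huv (congrArg Sum.inr (Fin.ext h))).elim
    · exact YY k j h hna' he'

end graph

/-- `H(r,d,3r-1)` is radially maximal. -/
theorem stmt_12 (r d : ℕ) (hrd : r < d) (hd : d + 2 ≤ 2 * r) :
    RadiallyMaximal (paperH r d) := by
  obtain ⟨m, hm⟩ : ∃ m, m = 2 * r - d := ⟨_, rfl⟩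
  have h2 : 2 ≤ m := by omega
  have hmr : m + 1 ≤ r := by omega
  have hdm : d = 2 * r - m := by omega
  have hrad := rad_ge h2 hmr hdm
  have hlt : ∀ G : SimpleGraph (Fin (2 * r - 1) ⊕ Fin r),
      (∃ w, ∀ t, G.dist w t ≤ r - 1) → graphRadius G < graphRadius (paperH r d) := by
    rintro G ⟨w, hw⟩
    have h1 : eccentricity G w ≤ r - 1 := Finset.sup_le fun t _ => hw t
    have h3 : graphRadius G ≤ eccentricity G w := ciInf_le ⟨0, by rintro _ ⟨_, rfl⟩; exact Nat.zero_le _⟩ w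
    omega
  refine ⟨conn h2 hmr hdm, ?_, ?_⟩
  · intro htop
    refine lt_irrefl _ (hlt (paperH r d) ⟨Sum.inl ⟨0, by omega⟩, fun t => ?_⟩)
    rw [htop, dist_top]
    split_ifs <;> omega
  · intro u v huv hna
    refine hlt _ (centre_exists h2 hmr hdm _ (dbd h2 hmr hdm _ le_sup_left) u v huv hna ?_)
    have : (paperH r d ⊔ SimpleGraph.edge u v).Adj u v := by
      rw [SimpleGraph.sup_adj, SimpleGraph.edge_adj]
      exact Or.inr ⟨Or.inl ⟨rfl, rfl⟩, huv⟩
    exact (dist_eq_one_iff_adj.2 this).le
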